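/- Let $T$ be a non-redundant decision tree structure of depth at most $d$ on $n$ boolean variables, with leaf set $\mathcal{L}$ of size $L$, such that every leaf of $T$ has depth at least $2d/3$. Then for every $\delta > 0$, $\Pr_{z \in \{0,1\}^L}[\, \bar{s}(T_z) < \mathbb{E}_z[\bar{s}(T_z)] - \delta \,] \le e^{-(9/8)\, 2^{d/3} \delta^2 / d^2}$, where $z$ is uniform. In particular, for every $\epsilon$ with $0 < \epsilon < 1$, $\Pr_{z}[\, \bar{s}(T_z) < (1-\epsilon) d/3 \,] \le e^{-2^{d/3 - 3} \epsilon^2}$. -/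

import Mathlib

/-- A full binary tree: every internal vertex has exactly two children. -/
inductive BTree : Type where
  | leaf : BTree
  | node : BTree → BTree → BTree

namespace BTree

/-- The depth of a full binary tree (maximum depth of a leaf; a single leaf has depth 0). -/
def depth : BTree → ℕ
  | .leaf => 0
  | .node l r => max l.depth r.depth + 1

/-- The minimum depth of a leaf of the tree. -/
def minDepth : BTree → ℕ
  | .leaf => 0
  | .node l r => min l.minDepth r.minDepth + 1

/-- The list of depths of the leaves of the tree. -/
def leafDepths : BTree → List ℕ
  | .leaf => [0]
  | .node l r => l.leafDepths.map (· + 1) ++ r.leafDepths.map (· + 1)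

end BTree

/-- A decision tree on `n` boolean variables, with leaves labelled by elements of `α`:
a full binary tree whose internal vertices are labelled with variables (elements of `Fin n`),
the two edges to the children corresponding to the value (false/true) of that variable. -/
inductive DTree (n : ℕ) (α : Type) : Type where
  | leaf : α → DTree n α
  | node : Fin n → DTree n α → DTree n α → DTree n α

namespace DTree

variable {n : ℕ} {α β : Type}

/-- Evaluate a decision tree on an input, returning the label of the leaf reached. -/
def eval : DTree n α → (Fin n → Bool) → α
  | .leaf a, _ => a
  | .node i l r, x => if x i then r.eval x else l.eval x

/-- Relabel the leaves of a decision tree. -/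
def map (f : α → β) : DTree n α → DTree n β
  | .leaf a => .leaf (f a)
  | .node i l r => .node i (l.map f) (r.map f)

/-- The list of leaf labels of a decision tree. -/
def leaves : DTree n α → List α
  | .leaf a => [a]
  | .node _ l r => l.leaves ++ r.leaves

/-- The depth of a decision tree (maximum depth of a leaf; a single leaf has depth 0). -/
def depth : DTree n α → ℕ
  | .leaf _ => 0
  | .node _ l r => max l.depth r.depth + 1

/-- The minimum depth of a leaf of a decision tree. -/
def minDepth : DTree n α → ℕ
  | .leaf _ => 0
  | .node _ l r => min l.minDepth r.minDepth + 1

/-- The length of the root-to-leaf path followed on input `x`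
(equivalently, the depth of the leaf reached, i.e. the number of queries made). -/
def pathLen : DTree n α → (Fin n → Bool) → ℕ
  | .leaf _, _ => 0
  | .node i l r, x => (if x i then r.pathLen x else l.pathLen x) + 1

/-- The depth of the leaf labelled `a` (assuming leaf labels are distinct). -/
def depthOf [DecidableEq α] : DTree n α → α → ℕ
  | .leaf _, _ => 0
  | .node _ l r, a => (if a ∈ l.leaves then l.depthOf a else r.depthOf a) + 1

/-- `t.NonRedundantFrom s` means no variable from `s` occurs in `t`, and no variable
occurs more than once on any root-to-leaf path of `t`. -/
def NonRedundantFrom : DTree n α → Finset (Fin n) → Prop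
  | .leaf _, _ => True
  | .node i l r, s =>
      i ∉ s ∧ l.NonRedundantFrom (insert i s) ∧ r.NonRedundantFrom (insert i s)

/-- A decision tree is non-redundant if no variable occurs more than once on any
root-to-leaf path. -/
def NonRedundant (t : DTree n α) : Prop := t.NonRedundantFrom ∅

/-- `t.Queries x i` means that on input `x`, some vertex on the root-to-leaf path
followed by `t` is labelled with variable `i`. -/
def Queries : DTree n α → (Fin n → Bool) → Fin n → Prop
  | .leaf _, _, _ => False
  | .node j l r, x, i => j = i ∨ (if x j then r.Queries x i else l.Queries x i)

end DTree

/-- The real number (0 or 1) corresponding to a boolean value. -/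
noncomputable def b2r (b : Bool) : ℝ := if b then 1 else 0

/-- Flip the `i`-th bit of the boolean string `x`. -/
def flipBit {n : ℕ} (x : Fin n → Bool) (i : Fin n) : Fin n → Bool :=
  Function.update x i (!x i)

/-- The average sensitivity (total influence) of a boolean function:
`s̄(f) = 2⁻ⁿ ∑_x ∑_i |f(x) - f(xⁱ)|`. -/
noncomputable def avgSens {n : ℕ} (f : (Fin n → Bool) → Bool) : ℝ :=
  (∑ x : Fin n → Bool, ∑ i : Fin n, |b2r (f x) - b2r (f (flipBit x i))|) / 2 ^ n

namespace DTree

theorem eval_map' {n : ℕ} {α β : Type} (f : α → β) (t : DTree n α) (x : Fin n → Bool) :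
    (t.map f).eval x = f (t.eval x) := by
  induction t with
  | leaf a => rfl
  | node i l r hl hr =>
    simp only [map, eval]
    split_ifs <;> assumption

theorem eval_mem {n : ℕ} {α : Type} (t : DTree n α) (x : Fin n → Bool) :
    t.eval x ∈ t.leaves := by
  induction t with
  | leaf a => simp [eval, leaves]
  | node i l r hl hr =>
    simp only [leaves, eval, List.mem_append]
    split_ifs
    · exact Or.inr hr
    · exact Or.inl hl

theorem pathLen_le {n : ℕ} {α : Type} (t : DTree n α) (x : Fin n → Bool) :
    t.pathLen x ≤ t.depth := by
  induction t with
  | leaf a => simp [pathLen]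
  | node i l r hl hr =>
    simp only [pathLen, depth]
    split_ifs <;> omega

theorem depthOf_eval {n : ℕ} {α : Type} [DecidableEq α] (t : DTree n α) (x : Fin n → Bool)
    (h : t.leaves.Nodup) : t.depthOf (t.eval x) = t.pathLen x := by
  induction t with
  | leaf a => rfl
  | node i l r hl hr =>
    simp only [leaves] at h
    have h1 := List.Nodup.of_append_left h
    have h2 := List.Nodup.of_append_right h
    have h3 := List.disjoint_of_nodup_append h
    simp only [depthOf, eval, pathLen]
    by_cases hx : x i
    · have : r.eval x ∉ l.leaves := fun hh => h3 hh (eval_mem r x)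
      simp [hx, this, hr h2]
    · simp [hx, eval_mem, hl h1]

theorem eval_flip {n : ℕ} {α : Type} (t : DTree n α) (s : Finset (Fin n))
    (h : t.NonRedundantFrom s) (x : Fin n → Bool) (i : Fin n) (hi : i ∈ s) :
    t.eval (flipBit x i) = t.eval x := by
  induction t generalizing s with
  | leaf a => rfl
  | node j l r hl hr =>
    obtain ⟨h0, h1, h2⟩ := h
    have hij : j ≠ i := fun e => h0 (e ▸ hi)
    simp only [eval, hl _ h1 (Finset.mem_insert_of_mem hi), hr _ h2 (Finset.mem_insert_of_mem hi)]
    simp [flipBit, hij]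

end DTree

theorem flipBit_flipBit {n : ℕ} (x : Fin n → Bool) (i : Fin n) :
    flipBit (flipBit x i) i = x := by
  funext k
  by_cases h : k = i
  · subst h; simp [flipBit]
  · simp [flipBit, h]

theorem flipBit_invol {n : ℕ} (i : Fin n) :
    Function.Involutive (fun x : Fin n → Bool => flipBit x i) :=
  fun x => flipBit_flipBit x i

theorem sum_flip {n : ℕ} (i : Fin n) (f : (Fin n → Bool) → ℝ) :
    ∑ x, f (flipBit x i) = ∑ x, f x :=
  Fintype.sum_equiv (flipBit_invol i).toPerm _ _ (fun _ => rfl)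

namespace DTree

theorem card_flip {n : ℕ} {α : Type} [DecidableEq α] (t : DTree n α) (s : Finset (Fin n))
    (h : t.NonRedundantFrom s) (hnd : t.leaves.Nodup) (x : Fin n → Bool) :
    (Finset.univ.filter (fun i => t.eval x ≠ t.eval (flipBit x i))).card = t.pathLen x := by
  induction t generalizing s with
  | leaf a => simp [eval, pathLen]
  | node j l r hl hr =>
    obtain ⟨h0, h1, h2⟩ := h
    simp only [leaves] at hnd
    have n1 := List.Nodup.of_append_left hnd
    have n2 := List.Nodup.of_append_right hnd
    have n3 := List.disjoint_of_nodup_append hnd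
    have key : ∀ u v : DTree n α, u.NonRedundantFrom (insert j s) → 
        (∀ y, u.eval x ≠ v.eval y) → (node j l r).eval x = u.eval x → 
        (node j l r).eval (flipBit x j) = v.eval (flipBit x j) →
        (∀ i, i ≠ j → (node j l r).eval (flipBit x i) = u.eval (flipBit x i)) →
        (Finset.univ.filter (fun i => (node j l r).eval x ≠ (node j l r).eval (flipBit x i))).card
         = (Finset.univ.filter (fun i => u.eval x ≠ u.eval (flipBit x i))).card + 1 := by
      intro u v hu huv e1 e2 e3
      rw [← Finset.card_insert_of_notMem (a := j)]
      · congr 1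
        ext i
        by_cases hi : i = j
        · subst hi
          simp [e1, e2, huv]
        · simp [e1, e3 i hi, hi]
      · simp [eval_flip u _ hu x j (Finset.mem_insert_self _ _)]
    by_cases hx : x j
    · rw [key r l h2 (fun y hy => n3 (hy ▸ eval_mem l y) (eval_mem r x)) (by simp [eval, hx])
        (by simp [eval, hx, flipBit]) (fun i hi => by simp [eval, flipBit, hi.symm, hx]),
        hr _ h2 n2]
      simp [pathLen, hx]
    · rw [key l r h1 (fun y hy => n3 (eval_mem l x) (hy ▸ eval_mem r y)) (by simp [eval, hx])
        (by simp [eval, hx, flipBit]) (fun i hi => by simp [eval, flipBit, hi.symm, hx]),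
        hl _ h1 n1]
      simp [pathLen, hx]

theorem prob_leaf {n : ℕ} {α : Type} [DecidableEq α] (t : DTree n α) (s : Finset (Fin n))
    (h : t.NonRedundantFrom s) (hnd : t.leaves.Nodup) (a : α) (ha : a ∈ t.leaves) :
    (∑ x : Fin n → Bool, if t.eval x = a then (1 : ℝ) else 0) * 2 ^ (t.depthOf a) = 2 ^ n := by
  induction t generalizing s with
  | leaf b =>
    simp only [leaves, List.mem_singleton] at ha
    simp [eval, ha, depthOf]
  | node j l r hl hr =>
    obtain ⟨h0, h1, h2⟩ := h
    simp only [leaves] at hnd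
    have n1 := List.Nodup.of_append_left hnd
    have n2 := List.Nodup.of_append_right hnd
    have n3 := List.disjoint_of_nodup_append hnd
    have half : ∀ (u : DTree n α) (b : Bool), u.NonRedundantFrom (insert j s) →
        (∑ x : Fin n → Bool, if u.eval x = a then (1 : ℝ) else 0)
        = (∑ x : Fin n → Bool, if x j = b ∧ u.eval x = a then (1 : ℝ) else 0) * 2 := by
      intro u b hu
      rw [mul_two]
      nth_rewrite 2 [← sum_flip j]
      rw [← Finset.sum_add_distrib]
      refine Finset.sum_congr rfl fun x _ => ?_
      rw [eval_flip u _ hu x j (Finset.mem_insert_self _ _)]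
      have : flipBit x j j = !x j := by simp [flipBit]
      rw [this]
      cases x j <;> cases b <;> by_cases hh : u.eval x = a <;> simp [hh]
    by_cases hal : a ∈ l.leaves
    · have har : ∀ x, r.eval x ≠ a := fun x hx => n3 hal (hx ▸ eval_mem r x)
      have := hl _ h1 n1 hal
      rw [half l false h1] at this
      simp only [depthOf, hal, if_true, pow_succ']
      rw [← this, mul_assoc]
      congr 1
      refine Finset.sum_congr rfl fun x _ => ?_
      cases hx : x j <;> simp [eval, hx, har]
    · have har : a ∈ r.leaves := by simpa [leaves, hal] using ha
      have hal' : ∀ x, l.eval x ≠ a := fun x hx => hal (hx ▸ eval_mem l x)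
      have := hr _ h2 n2 har
      rw [half r true h2] at this
      simp only [depthOf, hal, if_false, pow_succ']
      rw [← this, mul_assoc]
      congr 1
      refine Finset.sum_congr rfl fun x _ => ?_
      cases hx : x j <;> simp [eval, hx, hal']

end DTree

theorem mcd_mgf (L : ℕ) (F : (Fin L → Bool) → ℝ) (c : Fin L → ℝ)
    (hF : ∀ z j, |F z - F (flipBit z j)| ≤ c j) (s : ℝ) :
    (∑ z, Real.exp (s * F z)) / 2 ^ L ≤
      Real.exp (s * ((∑ z, F z) / 2 ^ L) + s ^ 2 * (∑ j, c j ^ 2) / 8) := by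
  induction L with
  | zero => simp
  | succ L ih =>
    have split : ∀ f : (Fin (L+1) → Bool) → ℝ, ∑ z, f z =
        ∑ w : Fin L → Bool, (f (Fin.cons false w) + f (Fin.cons true w)) := by
      intro f
      rw [← (Fin.consEquiv (fun _ : Fin (L+1) => Bool)).sum_comp, Fintype.sum_prod_type]
      simp [Finset.sum_add_distrib, Fin.consEquiv, add_comm]
    have fl0 : ∀ (b : Bool) (w : Fin L → Bool),
        flipBit (Fin.cons b w : Fin (L+1) → Bool) 0 = Fin.cons (!b) w := by
      intro b w
      simp [flipBit]
    have fls : ∀ (b : Bool) (w : Fin L → Bool) (j : Fin L),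
        flipBit (Fin.cons b w : Fin (L+1) → Bool) j.succ = Fin.cons b (flipBit w j) := by
      intro b w j
      simp [flipBit, Fin.cons_update]
    let G : (Fin L → Bool) → ℝ := fun w => (F (Fin.cons false w) + F (Fin.cons true w)) / 2
    have hG := ih G (fun j => c j.succ) (by
      intro w j
      have h1 := hF (Fin.cons false w) j.succ
      have h2 := hF (Fin.cons true w) j.succ
      rw [fls] at h1 h2
      simp only [G]
      rw [abs_le] at *
      constructor <;> linarith)
    have pt : ∀ w : Fin L → Bool, Real.exp (s * F (Fin.cons false w)) +
        Real.exp (s * F (Fin.cons true w)) ≤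
        2 * Real.exp (s ^ 2 * c 0 ^ 2 / 8) * Real.exp (s * G w) := by
      intro w
      have h1 := hF (Fin.cons false w) 0
      rw [fl0] at h1
      simp only [Bool.not_false] at h1
      set a := F (Fin.cons false w) with ha
      set b := F (Fin.cons true w) with hb
      have hc := Real.cosh_le_exp_half_sq (s * (a - b) / 2)
      have h2 : (a - b) ^ 2 ≤ c 0 ^ 2 := by
        rw [← sq_abs]; gcongr
      have h3 : Real.exp ((s * (a - b) / 2) ^ 2 / 2) ≤ Real.exp (s ^ 2 * c 0 ^ 2 / 8) := by
        apply Real.exp_le_exp.mpr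
        nlinarith [mul_le_mul_of_nonneg_left h2 (sq_nonneg s)]
      have e1 : Real.exp (s * a) + Real.exp (s * b) =
          2 * Real.cosh (s * (a - b) / 2) * Real.exp (s * G w) := by
        have hGw : G w = (a + b) / 2 := rfl
        rw [Real.cosh_eq, hGw]
        have q1 : s * a = s * (a - b) / 2 + s * ((a + b) / 2) := by ring
        have q2 : s * b = -(s * (a - b) / 2) + s * ((a + b) / 2) := by ring
        rw [q1, q2, Real.exp_add, Real.exp_add]
        ring
      rw [e1]
      have := hc.trans h3
      gcongr
    rw [split, split]
    calc _ ≤ (∑ w : Fin L → Bool, 2 * Real.exp (s ^ 2 * c 0 ^ 2 / 8) * Real.exp (s * G w)) / 2 ^ (L+1) := by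
          gcongr with w; exact pt w
      _ = Real.exp (s ^ 2 * c 0 ^ 2 / 8) * ((∑ w, Real.exp (s * G w)) / 2 ^ L) := by
          rw [← Finset.mul_sum, pow_succ]; field_simp; try ring
      _ ≤ Real.exp (s ^ 2 * c 0 ^ 2 / 8) * Real.exp (s * ((∑ z, G z) / 2 ^ L) + (s ^ 2 * ∑ j : Fin L, c j.succ ^ 2) / 8) := by gcongr
      _ = _ := by
          rw [← Real.exp_add, Fin.sum_univ_succ]
          congr 1
          simp only [G]
          rw [← Finset.sum_div, pow_succ]
          field_simp
          ring

theorem mcd (L : ℕ) (F : (Fin L → Bool) → ℝ) (c : Fin L → ℝ)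
    (hF : ∀ z j, |F z - F (flipBit z j)| ≤ c j) (V : ℝ) (hV : 0 < V) (hcV : ∑ j, c j ^ 2 ≤ V)
    (δ : ℝ) (hδ : 0 < δ) :
    (Set.ncard {z | F z < (∑ w, F w) / 2 ^ L - δ} : ℝ) / 2 ^ L ≤ Real.exp (-2 * δ ^ 2 / V) := by
  classical
  set E := (∑ w, F w) / 2 ^ L with hE
  have h := mcd_mgf L F c hF (-(4 * δ / V))
  rw [← hE] at h
  set s := 4 * δ / V with hs
  have hs0 : 0 < s := by positivity
  have hcard : (Set.ncard {z | F z < E - δ} : ℝ) * Real.exp (-s * (E - δ)) ≤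
      ∑ z, Real.exp (-s * F z) := by
    have : {z | F z < E - δ} = ((Finset.univ.filter (fun z => F z < E - δ) : Finset _) : Set (Fin L → Bool)) := by
      ext; simp
    rw [this, Set.ncard_coe_finset, ← nsmul_eq_mul]
    refine le_trans (Finset.card_nsmul_le_sum _ (fun z => Real.exp (-s * F z)) _ ?_)
      (Finset.sum_le_sum_of_subset_of_nonneg (Finset.filter_subset _ _) (fun _ _ _ => by positivity))
    intro z hz
    simp only [Finset.mem_filter] at hz
    apply Real.exp_le_exp.mpr
    nlinarith [hz.2]
  have h2 : (Set.ncard {z | F z < E - δ} : ℝ) / 2 ^ L * Real.exp (-s * (E - δ)) ≤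
      Real.exp (-s * E + (-s) ^ 2 * (∑ j, c j ^ 2) / 8) := by
    refine le_trans ?_ h
    rw [div_mul_eq_mul_div]
    gcongr
  have h3 : Real.exp (-s * E + (-s) ^ 2 * (∑ j, c j ^ 2) / 8) ≤
      Real.exp (-2 * δ ^ 2 / V) * Real.exp (-s * (E - δ)) := by
    rw [← Real.exp_add]
    apply Real.exp_le_exp.mpr
    have : (-s) ^ 2 * (∑ j, c j ^ 2) / 8 ≤ s ^ 2 * V / 8 := by
      rw [neg_sq]; gcongr
    have e : s ^ 2 * V / 8 = -2 * δ ^ 2 / V + s * δ := by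
      rw [hs]; field_simp; ring
    linarith
  exact le_of_mul_le_mul_right (h2.trans h3) (Real.exp_pos _)

section main
variable {n L : ℕ} (t : DTree n (Fin L))

theorem sens_term (z : Fin L → Bool) (a b : Fin L) :
    |b2r (z a) - b2r (z b)| = if z a = z b then 0 else 1 := by
  cases z a <;> cases z b <;> simp [b2r]

theorem exp_term (a b : Fin L) :
    ∑ z : Fin L → Bool, |b2r (z a) - b2r (z b)| = if a = b then 0 else 2 ^ L / 2 := by
  split_ifs with h
  · subst h; simp
  · have h1 : ∑ z : Fin L → Bool, |b2r (z a) - b2r (z b)| +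
      ∑ z : Fin L → Bool, |b2r (z a) - b2r (z b)| = 2 ^ L := by
      nth_rewrite 2 [← sum_flip a]
      rw [← Finset.sum_add_distrib]
      have : ∀ z : Fin L → Bool, |b2r (z a) - b2r (z b)| +
        |b2r (flipBit z a a) - b2r (flipBit z a b)| = 1 := by
        intro z
        have h1 : flipBit z a a = !z a := by simp [flipBit]
        have h2 : flipBit z a b = z b := by simp [flipBit, Ne.symm h]
        rw [h1, h2]
        cases z a <;> cases z b <;> simp [b2r]
      simp [this]
    linarith

theorem expectation (ht : t.NonRedundant) (hnd : t.leaves.Nodup) :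
    (∑ w : Fin L → Bool, avgSens (fun x => (t.map w).eval x)) / 2 ^ L =
      (∑ x, (t.pathLen x : ℝ)) / 2 ^ n / 2 := by
  simp only [avgSens, DTree.eval_map']
  rw [← Finset.sum_div, Finset.sum_comm]
  have : ∀ x : Fin n → Bool, ∑ w : Fin L → Bool, ∑ i : Fin n,
      |b2r (w (t.eval x)) - b2r (w (t.eval (flipBit x i)))| = t.pathLen x * (2 ^ L / 2) := by
    intro x
    rw [Finset.sum_comm, ← DTree.card_flip t ∅ ht hnd x]
    simp only [exp_term]
    rw [Finset.card_filter]
    push_cast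
    rw [Finset.sum_mul]
    refine Finset.sum_congr rfl fun i _ => ?_
    split_ifs <;> simp_all
  simp only [this]
  rw [← Finset.sum_mul]
  field_simp

theorem bdd_diff (ht : t.NonRedundant) (hnd : t.leaves.Nodup) (hsurj : ∀ j : Fin L, j ∈ t.leaves)
    (z : Fin L → Bool) (j : Fin L) :
    |avgSens (fun x => (t.map z).eval x) - avgSens (fun x => (t.map (flipBit z j)).eval x)|
      ≤ 2 * t.depthOf j * (1 / 2) ^ t.depthOf j := by
  simp only [avgSens, DTree.eval_map']
  rw [← sub_div, abs_div, abs_of_pos (by positivity : (0:ℝ) < 2 ^ n),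
    div_le_iff₀ (by positivity), ← Finset.sum_sub_distrib]
  simp only [← Finset.sum_sub_distrib]
  let A : (Fin n → Bool) → Fin n → ℝ := fun x i =>
    if t.eval x = j ∧ t.eval x ≠ t.eval (flipBit x i) then 1 else 0
  have hA : ∑ x, ∑ i, A x i = t.depthOf j * (1 / 2) ^ t.depthOf j * 2 ^ n := by
    have h1 : ∀ x, ∑ i, A x i = t.depthOf j * (if t.eval x = j then (1:ℝ) else 0) := by
      intro x
      by_cases hx : t.eval x = j
      · have := DTree.card_flip t ∅ ht hnd x
        rw [← DTree.depthOf_eval t x hnd, Finset.card_filter, hx] at this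
        simp [A, hx, ← this]
      · simp [A, hx]
    simp only [h1]
    rw [← Finset.mul_sum, ← DTree.prob_leaf t ∅ ht hnd j (hsurj j)]
    have : (1/2 : ℝ) ^ t.depthOf j * 2 ^ t.depthOf j = 1 := by
      rw [← mul_pow]; norm_num
    linear_combination (-(t.depthOf j : ℝ) * (∑ x, if t.eval x = j then (1:ℝ) else 0)) * this
  have hA2 : ∑ x, ∑ i, A (flipBit x i) i = ∑ x, ∑ i, A x i := by
    rw [Finset.sum_comm]
    rw [Finset.sum_comm (f := fun x i => A x i)]
    exact Finset.sum_congr rfl fun i _ => sum_flip i (fun x => A x i)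
  have hpt : ∀ x i, |(|b2r (z (t.eval x)) - b2r (z (t.eval (flipBit x i)))| -
      |b2r (flipBit z j (t.eval x)) - b2r (flipBit z j (t.eval (flipBit x i)))|)| ≤
      A x i + A (flipBit x i) i := by
    intro x i
    simp only [A, flipBit_flipBit, sens_term]
    generalize t.eval x = a
    generalize t.eval (flipBit x i) = b
    by_cases hab : a = b
    · subst hab; simp
    by_cases ha : a = j
    · have hb : b ≠ j := fun h => hab (ha.trans h.symm)
      simp only [ha, hb]
      split_ifs <;> simp_all
    · by_cases hb : b = j
      · simp only [ha, hb]
        split_ifs <;> simp_all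
      · have h1 : flipBit z j a = z a := by simp [flipBit, ha]
        have h2 : flipBit z j b = z b := by simp [flipBit, hb]
        simp [h1, h2, ha, hb]
  calc _ ≤ ∑ x, ∑ i, (A x i + A (flipBit x i) i) := by
        refine (Finset.abs_sum_le_sum_abs _ _).trans (Finset.sum_le_sum fun x _ => ?_)
        exact (Finset.abs_sum_le_sum_abs _ _).trans (Finset.sum_le_sum fun i _ => hpt x i)
    _ = _ := by
        simp only [Finset.sum_add_distrib]
        rw [hA2, hA]; ring

theorem sum_prob (ht : t.NonRedundant) (hnd : t.leaves.Nodup) (hsurj : ∀ j : Fin L, j ∈ t.leaves) :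
    ∑ j, (1 / 2 : ℝ) ^ t.depthOf j = 1 := by
  have h : ∀ j, (1 / 2 : ℝ) ^ t.depthOf j =
      (∑ x : Fin n → Bool, if t.eval x = j then (1 : ℝ) else 0) / 2 ^ n := by
    intro j
    rw [eq_div_iff (by positivity), ← DTree.prob_leaf t ∅ ht hnd j (hsurj j)]
    have : (1/2 : ℝ) ^ t.depthOf j * 2 ^ t.depthOf j = 1 := by
      rw [← mul_pow]; norm_num
    linear_combination (∑ x, if t.eval x = j then (1:ℝ) else 0) * this
  simp only [h]
  rw [← Finset.sum_div, Finset.sum_comm]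
  simp

theorem exists_eval (ht : t.NonRedundant) (hnd : t.leaves.Nodup) (j : Fin L) (hj : j ∈ t.leaves) :
    ∃ x, t.eval x = j := by
  by_contra! hc
  have := DTree.prob_leaf t ∅ ht hnd j hj
  simp only [hc, if_false, Finset.sum_const_zero, zero_mul] at this
  have h2 : (0:ℝ) < 2 ^ n := by positivity
  linarith

theorem num_bound (d D : ℕ) (hd : 2 ≤ d) (hD : D ≤ d) (h : (2 * d : ℝ) / 3 ≤ D) :
    4 * (D : ℝ) ^ 2 * (1 / 2) ^ D ≤ 16 / 9 * d ^ 2 / (2 : ℝ) ^ ((d : ℝ) / 3) := by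
  rw [le_div_iff₀ (by positivity)]
  set y := (2 : ℝ) ^ ((d : ℝ) / 3) with hy
  have hy0 : 0 < y := by positivity
  have hy3 : y ^ 3 = 2 ^ d := by
    rw [hy, ← Real.rpow_natCast, ← Real.rpow_mul (by norm_num)]
    rw [← Real.rpow_natCast]
    congr 1
    push_cast; ring
  have h' : 2 * d ≤ 3 * D := by
    have : (2 * d : ℝ) ≤ 3 * D := by linarith
    exact_mod_cast this
  rcases (by omega : d = 2 ∨ d = 3 ∨ 4 ≤ d) with h2 | h3 | h4
  · subst h2
    have : D = 2 := by omega
    subst this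
    have : y ≤ 16 / 9 := by
      by_contra! hc
      have : (16/9 : ℝ) ^ 3 < y ^ 3 := by gcongr
      rw [hy3] at this; norm_num at this
    norm_num; linarith
  · subst h3
    have : y ≤ 2 := by
      by_contra! hc
      have : (2 : ℝ) ^ 3 < y ^ 3 := by gcongr
      rw [hy3] at this; norm_num at this
    rcases (by omega : D = 2 ∨ D = 3) with h | h <;> subst h <;> norm_num <;> linarith
  · have hy9 : 9 / 4 ≤ y := by
      by_contra! hc
      have h1 : y ^ 3 < (9/4 : ℝ) ^ 3 := by gcongr
      have h2 : (2:ℝ) ^ 4 ≤ 2 ^ d := pow_le_pow_right₀ (by norm_num) h4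
      rw [hy3] at h1; norm_num at h1 h2; linarith
    have hyD : y ^ 2 ≤ 2 ^ D := by
      have : y ^ 2 = (2:ℝ) ^ ((2 * d : ℝ) / 3) := by
        rw [hy, ← Real.rpow_natCast, ← Real.rpow_mul (by norm_num)]
        congr 1
        push_cast; ring
      rw [this, ← Real.rpow_natCast]
      exact Real.rpow_le_rpow_of_exponent_le (by norm_num) h
    have hp : (1/2 : ℝ) ^ D * 2 ^ D = 1 := by rw [← mul_pow]; norm_num
    have hq : (1/2 : ℝ) ^ D * y ^ 2 ≤ 1 := by
      refine le_trans ?_ hp.le; gcongr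
    have hr : (1/2 : ℝ) ^ D * y ≤ 4 / 9 := by
      have : 0 ≤ (1/2 : ℝ) ^ D * y := by positivity
      nlinarith
    have hDd : (D : ℝ) ^ 2 ≤ d ^ 2 := by gcongr
    calc _ = 4 * ((D : ℝ) ^ 2 * ((1 / 2) ^ D * y)) := by ring
      _ ≤ 4 * ((d : ℝ) ^ 2 * (4 / 9)) := by gcongr
      _ = _ := by ring

theorem small_case (F : (Fin L → Bool) → ℝ) (j : Fin L) (E δ : ℝ) (hδ : 0 < δ)
    (h0 : ∀ z, 0 ≤ F z) (h1 : ∀ z, F z + F (flipBit z j) = 1) (hE : E ≤ 1 / 2) :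
    (Set.ncard {z | F z < E - δ} : ℝ) / 2 ^ L ≤ 
      Real.exp (-(9 / 8) * (2 : ℝ) ^ (((1:ℕ) : ℝ) / 3) * δ ^ 2 / ((1 : ℕ) : ℝ) ^ 2) := by
  classical
  rcases le_or_gt (1/2) δ with h | h
  · have : {z | F z < E - δ} = ∅ := by
      ext z; simp; linarith [h0 z]
    rw [this]; simp; positivity
  · have hs : {z | F z < E - δ} = ((Finset.univ.filter (fun z => F z < E - δ) : Finset _) : Set (Fin L → Bool)) := by
      ext; simp
    rw [hs, Set.ncard_coe_finset, Finset.card_filter]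
    push_cast
    have hle : ∑ z : Fin L → Bool, (if F z < E - δ then (1:ℝ) else 0) + 
       ∑ z : Fin L → Bool, (if F z < E - δ then (1:ℝ) else 0) ≤ 2 ^ L := by
      nth_rewrite 2 [← sum_flip j]
      rw [← Finset.sum_add_distrib]
      calc _ ≤ ∑ z : Fin L → Bool, (1:ℝ) := by
            refine Finset.sum_le_sum fun z _ => ?_
            have := h1 z
            split_ifs <;> first | linarith | norm_num
        _ = _ := by simp
    have hhalf : (∑ z : Fin L → Bool, (if F z < E - δ then (1:ℝ) else 0)) / 2 ^ L ≤ 1 / 2 := by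
      rw [div_le_iff₀ (by positivity)]; linarith
    refine hhalf.trans ?_
    set y := (2 : ℝ) ^ ((1 : ℝ) / 3) with hy
    have hy0 : 0 < y := by positivity
    have hy3 : y ^ 3 = 2 := by
      rw [hy, ← Real.rpow_natCast, ← Real.rpow_mul (by norm_num)]
      norm_num
    have hyle : y ≤ 4 / 3 := by
      by_contra! hc
      have : (4/3 : ℝ) ^ 3 < y ^ 3 := by gcongr
      rw [hy3] at this; norm_num at this
    have hδ2 : δ ^ 2 ≤ 1 / 4 := by nlinarith
    have hprod : y * δ ^ 2 ≤ 4 / 3 * (1 / 4) := by gcongr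
    refine le_trans ?_ (Real.add_one_le_exp _)
    nlinarith

end main

theorem avgSens_nonneg {n : ℕ} (f : (Fin n → Bool) → Bool) : 0 ≤ avgSens f := by
  unfold avgSens
  positivity

theorem d_one {n L : ℕ} (t : DTree n (Fin L)) (ht : t.NonRedundant) (hnd : t.leaves.Nodup)
    (h1 : ∀ x, t.pathLen x = 1) : ∃ j : Fin L, ∀ z : Fin L → Bool,
    avgSens (fun x => (t.map z).eval x) + avgSens (fun x => (t.map (flipBit z j)).eval x) = 1 := by
  match t with
  | .leaf a => simpa [DTree.pathLen] using h1 (fun _ => false)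
  | .node i l r =>
    have hl : ∃ a, l = .leaf a := by
      cases l with
      | leaf a => exact ⟨a, rfl⟩
      | node k u v => simpa [DTree.pathLen] using h1 (fun _ => false)
    have hr : ∃ a, r = .leaf a := by
      cases r with
      | leaf a => exact ⟨a, rfl⟩
      | node k u v => simpa [DTree.pathLen] using h1 (fun _ => true)
    obtain ⟨a, rfl⟩ := hl
    obtain ⟨b, rfl⟩ := hr
    have hab : a ≠ b := by simpa [DTree.leaves] using hnd
    have key : ∀ z : Fin L → Bool, avgSens (fun x => ((DTree.node i (.leaf a) (.leaf b)).map z).eval x)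
       = |b2r (z a) - b2r (z b)| := by
      intro z
      simp only [avgSens, DTree.eval_map']
      have : ∀ x : Fin n → Bool, ∑ k, |b2r (z ((DTree.node i (.leaf a) (.leaf b)).eval x)) -
        b2r (z ((DTree.node i (.leaf a) (.leaf b)).eval (flipBit x k)))| = |b2r (z a) - b2r (z b)| := by
        intro x
        rw [Finset.sum_eq_single i]
        · cases hx : x i <;> simp [DTree.eval, flipBit, hx, abs_sub_comm]
        · intro k _ hk
          simp [DTree.eval, flipBit, Ne.symm hk]
        · simp
      simp [this]
    refine ⟨a, fun z => ?_⟩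
    rw [key, key]
    have h1 : flipBit z a a = !z a := by simp [flipBit]
    have h2 : flipBit z a b = z b := by simp [flipBit, Ne.symm hab]
    rw [h1, h2]
    cases z a <;> cases z b <;> simp [b2r]

/-- Let `T` be a non-redundant decision tree structure of depth at most
`d` on `n` boolean variables, with leaf set indexed by `Fin L` (each index occurring at
exactly one leaf), such that every leaf of `T` has depth at least `2d/3`. Then for every
`δ > 0`, `Pr_{z}[s̄(T_z) < E_z[s̄(T_z)] - δ] ≤ exp(-(9/8) 2^{d/3} δ² / d²)`, where `z` is
uniform on `{0,1}^L`. In particular, for every `ε` with `0 < ε < 1`,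
`Pr_z[s̄(T_z) < (1-ε) d/3] ≤ exp(-2^{d/3 - 3} ε²)`. -/
theorem avgSens_concentration (n L d : ℕ) (t : DTree n (Fin L))
    (ht : t.NonRedundant) (hnodup : t.leaves.Nodup)
    (hsurj : ∀ j : Fin L, j ∈ t.leaves)
    (hdepth : t.depth ≤ d)
    (hleaf : ∀ ℓ : Fin L, (2 * d : ℝ) / 3 ≤ (t.depthOf ℓ : ℝ)) :
    (∀ δ : ℝ, 0 < δ →
      (Set.ncard {z : Fin L → Bool |
          avgSens (fun x => (t.map z).eval x)
            < (∑ w : Fin L → Bool, avgSens (fun x => (t.map w).eval x)) / 2 ^ L - δ} : ℝ)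
          / 2 ^ L
        ≤ Real.exp (-(9 / 8) * (2 : ℝ) ^ ((d : ℝ) / 3) * δ ^ 2 / (d : ℝ) ^ 2)) ∧
    (∀ ε : ℝ, 0 < ε → ε < 1 →
      (Set.ncard {z : Fin L → Bool |
          avgSens (fun x => (t.map z).eval x) < (1 - ε) * d / 3} : ℝ) / 2 ^ L
        ≤ Real.exp (-(2 : ℝ) ^ ((d : ℝ) / 3 - 3) * ε ^ 2)) := by
  have hpl : ∀ x, (2 * d : ℝ) / 3 ≤ t.pathLen x := fun x => by
    rw [← DTree.depthOf_eval t x hnodup]; exact hleaf _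
  have hpu : ∀ x, t.pathLen x ≤ d := fun x => (DTree.pathLen_le t x).trans hdepth
  have hDu : ∀ j, t.depthOf j ≤ d := fun j => by
    obtain ⟨x, rfl⟩ := exists_eval t ht hnodup j (hsurj j)
    rw [DTree.depthOf_eval t x hnodup]; exact hpu x
  have first : ∀ δ : ℝ, 0 < δ →
      (Set.ncard {z : Fin L → Bool |
          avgSens (fun x => (t.map z).eval x)
            < (∑ w : Fin L → Bool, avgSens (fun x => (t.map w).eval x)) / 2 ^ L - δ} : ℝ)
          / 2 ^ L
        ≤ Real.exp (-(9 / 8) * (2 : ℝ) ^ ((d : ℝ) / 3) * δ ^ 2 / (d : ℝ) ^ 2) := by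
    intro δ hδ
    rcases (by omega : d = 0 ∨ d = 1 ∨ 2 ≤ d) with h0 | h1 | h2
    · subst h0
      simp only [Nat.cast_zero, ne_eq, OfNat.ofNat_ne_zero, not_false_eq_true, zero_pow, div_zero,
        Real.exp_zero]
      rw [div_le_one (by positivity)]
      have := Set.ncard_le_card (s := {z : Fin L → Bool |
          avgSens (fun x => (t.map z).eval x)
            < (∑ w : Fin L → Bool, avgSens (fun x => (t.map w).eval x)) / 2 ^ L - δ})
      simp only [Nat.card_eq_fintype_card, Fintype.card_fun, Fintype.card_bool, Fintype.card_fin] at this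
      exact_mod_cast this
    · subst h1
      have hp1 : ∀ x, t.pathLen x = 1 := fun x => by
        have h := hpl x
        have h' := hpu x
        have : t.pathLen x ≠ 0 := fun e => by rw [e] at h; norm_num at h
        omega
      obtain ⟨j, hj⟩ := d_one t ht hnodup hp1
      refine small_case (fun z => avgSens (fun x => (t.map z).eval x)) j _ δ hδ
        (fun z => avgSens_nonneg _) hj ?_
      rw [expectation t ht hnodup]
      simp [hp1]
    · have hd0 : (0:ℝ) < d := by exact_mod_cast (by omega : 0 < d)
      have := mcd L (fun z => avgSens (fun x => (t.map z).eval x)) _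
        (bdd_diff t ht hnodup hsurj) (16 / 9 * d ^ 2 / (2 : ℝ) ^ ((d : ℝ) / 3)) (by positivity) (by
          calc _ = ∑ j, (4 * (t.depthOf j : ℝ) ^ 2 * (1 / 2) ^ t.depthOf j) * (1 / 2) ^ t.depthOf j :=
                Finset.sum_congr rfl fun j _ => by ring
            _ ≤ ∑ j, (16 / 9 * d ^ 2 / (2 : ℝ) ^ ((d : ℝ) / 3)) * (1 / 2) ^ t.depthOf j := by
                refine Finset.sum_le_sum fun j _ => ?_
                exact mul_le_mul_of_nonneg_right (num_bound d _ h2 (hDu j) (hleaf j)) (by positivity)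
            _ = _ := by rw [← Finset.mul_sum, sum_prob t ht hnodup hsurj, mul_one]) δ hδ
      refine this.trans (le_of_eq ?_)
      congr 1
      field_simp
      ring
  refine ⟨first, fun ε hε hε1 => ?_⟩
  rcases Nat.eq_zero_or_pos d with h0 | hd
  · have : {z : Fin L → Bool | avgSens (fun x => (t.map z).eval x) < (1 - ε) * d / 3} = ∅ := by
      ext z
      simp only [h0, Set.mem_ofPred_eq, Set.mem_empty_iff_false, iff_false, not_lt]
      simpa using avgSens_nonneg _
    rw [this]
    simp only [Set.ncard_empty, Nat.cast_zero, zero_div]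
    positivity
  · have hd0 : (0:ℝ) < d := by exact_mod_cast hd
    have h := first (ε * d / 3) (by positivity)
    have hE : (d : ℝ) / 3 ≤ (∑ w : Fin L → Bool, avgSens (fun x => (t.map w).eval x)) / 2 ^ L := by
      rw [expectation t ht hnodup]
      have : ∑ x : Fin n → Bool, (2 * d : ℝ) / 3 ≤ ∑ x, (t.pathLen x : ℝ) :=
        Finset.sum_le_sum fun x _ => hpl x
      simp only [Finset.sum_const, Finset.card_univ, Fintype.card_fun, Fintype.card_bool,
        Fintype.card_fin, nsmul_eq_mul, Nat.cast_pow, Nat.cast_ofNat] at this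
      have h2 : (2 * d : ℝ) / 3 ≤ (∑ x, (t.pathLen x : ℝ)) / 2 ^ n := by
        rw [le_div_iff₀ (by positivity)]; linarith
      linarith
    refine le_trans ?_ (h.trans (le_of_eq ?_))
    · gcongr
      · exact Set.toFinite _
      · linarith
    · congr 1
      rw [Real.rpow_sub (by norm_num)]
      norm_num
      field_simp
      ring
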